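/- Let κ > 0, h > 0 and let q₁, q₂ ∈ 𝒬(κ,h) be right-continuous functions with q₁ + q₂ not identically zero. Then there exists a random vector (A,B) such that A satisfies Assumption (A1) with parameters κ and h, E[|B|^κ] < ∞, and the unique solution X (independent of (A,B)) of the perpetuity equation X =_d AX + B satisfies lim_{n→∞} x^κ e^{κnh} P(X > x e^{nh}) = q₁(x) for every continuity point x > 0 of q₁ and lim_{n→∞} x^κ e^{κnh} P(X < −x e^{nh}) = q₂(x) for every continuity point x > 0 of q₂. -/

import Mathlib

open MeasureTheory ProbabilityTheory Filter Topology

noncomputable section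

/-- `q ∈ 𝒬(κ,h)`: `q : (0,∞) → [0,∞)`, `x ↦ x^{-κ} q(x)` is nonincreasing on `(0,∞)`,
and `q(x e^h) = q(x)` for all `x > 0`. -/
def MemQ (κ h : ℝ) (q : ℝ → ℝ) : Prop :=
  (∀ x : ℝ, 0 < x → 0 ≤ q x) ∧
  AntitoneOn (fun x : ℝ => x ^ (-κ) * q x) (Set.Ioi (0 : ℝ)) ∧
  (∀ x : ℝ, 0 < x → q (x * Real.exp h) = q x)

/-- The conditional distribution of `log A` given `A ≠ 0` is arithmetic with span `h`:
given `A ≠ 0`, `log A ∈ hℤ` a.s., and `h` is the largest positive number with this property. -/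
def CondLogArithSpan {Ω : Type*} [MeasurableSpace Ω] (P : Measure Ω) (A : Ω → ℝ)
    (h : ℝ) : Prop :=
  0 < h ∧
  P {ω | A ω ≠ 0 ∧ ∀ k : ℤ, Real.log (A ω) ≠ (k : ℝ) * h} = 0 ∧
  ∀ h' : ℝ, 0 < h' →
    P {ω | A ω ≠ 0 ∧ ∀ k : ℤ, Real.log (A ω) ≠ (k : ℝ) * h'} = 0 → h' ≤ h

/-- Assumption (A1): `A ≥ 0` a.s., `E A^κ = 1`, `E[A^κ log₊ A] < ∞`, and `log A`
conditioned on `A ≠ 0` is arithmetic with span `h`. -/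
def AssumptionA1 {Ω : Type*} [MeasurableSpace Ω] (P : Measure Ω) (A : Ω → ℝ)
    (κ h : ℝ) : Prop :=
  0 < κ ∧ (∀ᵐ ω ∂P, 0 ≤ A ω) ∧ (∫ ω, A ω ^ κ ∂P) = 1 ∧
  (∫⁻ ω, ENNReal.ofReal (A ω ^ κ * max (Real.log (A ω)) 0) ∂P) < ⊤ ∧
  CondLogArithSpan P A h

/-- An antitone right-continuous function on `(0,∞)`, cut off outside `[a,b]`, is the tail
function of a finite measure. -/
theorem exists_measure_Ioi_eq {G : ℝ → ℝ} (hG : AntitoneOn G (Set.Ioi 0))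
    (hrc : ∀ x : ℝ, 0 < x → ContinuousWithinAt G (Set.Ici x) x) {a b : ℝ} (ha : 0 < a)
    (hab : a ≤ b) :
    ∃ ν : Measure ℝ, ν Set.univ = ENNReal.ofReal (G a - G b) ∧ ν (Set.Iic 0) = 0 ∧
      ∀ y, ν (Set.Ioi y) = ENNReal.ofReal (G (max a (min y b)) - G b) := by
  have hpos : ∀ y, 0 < max a (min y b) := fun y => lt_max_of_lt_left ha
  have hmono : Monotone fun y => max a (min y b) := fun x y hxy => by dsimp only; gcongr
  let S : StieltjesFunction ℝ :=
    { toFun := fun y => -G (max a (min y b))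
      mono' := fun x y hxy => neg_le_neg (hG (hpos x) (hpos y) (hmono hxy))
      right_continuous' := fun x => by
        refine ContinuousWithinAt.neg ?_
        refine (hrc _ (hpos x)).comp (f := fun y => max a (min y b)) ?_ ?_
        · exact (by fun_prop : Continuous fun y => max a (min y b)).continuousWithinAt
        · exact fun y hy => hmono hy }
  have hS : ∀ y, S y = -G (max a (min y b)) := fun _ => rfl
  have hbot : Tendsto S atBot (𝓝 (-G a)) := by
    refine tendsto_const_nhds.congr' ?_
    filter_upwards [eventually_le_atBot a] with y hy
    rw [hS, max_eq_left ((min_le_left _ _).trans hy)]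
  have htop : Tendsto S atTop (𝓝 (-G b)) := by
    refine tendsto_const_nhds.congr' ?_
    filter_upwards [eventually_ge_atTop b] with y hy
    rw [hS, min_eq_right hy, max_eq_right hab]
  refine ⟨S.measure, ?_, ?_, fun y => ?_⟩
  · rw [S.measure_univ hbot htop]
    congr 1; ring
  · rw [S.measure_Iic hbot, hS, max_eq_left ((min_le_left _ _).trans ha.le)]
    simp
  · rw [S.measure_Ioi htop, hS]
    congr 1; ring

/-- An antitone solution of the tail recursion agrees with `G` on `[a,∞)`. -/
theorem tail_eq_of_recursion {T G : ℝ → ℝ} {a c r : ℝ} (ha : 0 < a) (hc : 1 < c) (hr : 0 < r)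
    (hr1 : r < 1) (hG : ∀ y, 0 < y → G (y * c) = r * G y) (hT : Antitone T)
    (hrec : ∀ y, 0 ≤ y → T y = G (max a (min y (a * c))) - G (a * c) + r * T (y / c)) :
    ∀ y, a ≤ y → T y = G y := by
  have hc0 : 0 < c := by linarith
  have hac : a ≤ a * c := by nlinarith
  have hT0 : T 0 = G a := by
    have h0 := hrec 0 le_rfl
    rw [max_eq_left ((min_le_left _ _).trans ha.le), hG a ha, zero_div] at h0
    have : (1 - r) * (T 0 - G a) = 0 := by linarith
    rcases mul_eq_zero.1 this with h | h <;> linarith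
  have hsmall : ∀ y, 0 ≤ y → y < a → T y = G a := by
    intro y hy hya
    have h0 := hrec y hy
    rw [max_eq_left ((min_le_left _ _).trans hya.le), hG a ha] at h0
    have h1 : T y ≤ T (y / c) := hT (div_le_self hy hc.le)
    have h2 : T y ≤ T 0 := hT hy
    nlinarith
  have key : ∀ n : ℕ, ∀ y, a ≤ y → y < a * c ^ n → T y = G y := by
    intro n
    induction n with
    | zero => intro y h1 h2; simp at h2; linarith
    | succ n ih =>
      intro y h1 h2
      have hy : 0 < y := ha.trans_le h1
      have hyc : y / c * c = y := div_mul_cancel₀ _ hc0.ne'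
      rw [hrec y hy.le]
      rcases lt_or_ge y (a * c) with h | h
      · rw [hsmall (y / c) (by positivity) ((div_lt_iff₀ hc0).2 h), min_eq_left h.le,
          max_eq_right h1, hG a ha]
        ring
      · rw [ih (y / c) ((le_div_iff₀ hc0).2 h) ((div_lt_iff₀ hc0).2 (by rwa [mul_assoc, ← pow_succ])),
          ← hG _ (by positivity), hyc, min_eq_right h, max_eq_right hac]
        ring
  intro y hy
  obtain ⟨n, hn⟩ := pow_unbounded_of_one_lt (y / a) hc
  exact key n y hy (by rwa [div_lt_iff₀' ha] at hn)

/-- The law of `c ^ N * B`, with `N` geometric and independent of `B`, as a fixed point. -/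
theorem exists_eq_add_smul_map (m : Measure ℝ) (p : ENNReal) (hp : p < 1)
    (hm : m Set.univ = 1 - p) (c : ℝ) :
    ∃ μ : Measure ℝ, IsProbabilityMeasure μ ∧ μ = m + p • μ.map (fun x => c * x) := by
  have hmeas : ∀ k : ℕ, Measurable fun x : ℝ => c ^ k * x := fun k => by fun_prop
  have happ : ∀ s, MeasurableSet s → (Measure.sum fun k : ℕ => p ^ k • m.map (fun x => c ^ k * x)) s
      = ∑' k : ℕ, p ^ k * m ((fun x => c ^ k * x) ⁻¹' s) := by
    intro s hs
    rw [Measure.sum_apply _ hs]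
    congr 1; ext k
    rw [Measure.smul_apply, Measure.map_apply (hmeas k) hs, smul_eq_mul]
  refine ⟨Measure.sum fun k : ℕ => p ^ k • m.map (fun x => c ^ k * x), ⟨?_⟩, ?_⟩
  · rw [happ _ MeasurableSet.univ]
    simp only [Set.preimage_univ, hm]
    rw [ENNReal.tsum_mul_right, ENNReal.tsum_geometric]
    exact ENNReal.inv_mul_cancel (tsub_pos_of_lt hp).ne' (by finiteness)
  · ext s hs
    rw [Measure.add_apply, Measure.smul_apply, Measure.map_apply (by fun_prop) hs, happ _ hs,
      happ _ (measurableSet_preimage (by fun_prop) hs), tsum_eq_zero_add' ENNReal.summable,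
      smul_eq_mul, ← ENNReal.tsum_mul_left]
    congr 1
    · simp
    · congr 1; ext k
      rw [← mul_assoc, pow_succ' p]
      congr 2
      ext x
      simp [pow_succ', mul_assoc]

/-- Joint law of `(A,B)`: `(c,0)` with mass `p`, otherwise `A = 0` and `B` distributed as `m`. -/
def pairLaw (m : Measure ℝ) (p : ENNReal) (c : ℝ) : Measure (ℝ × ℝ) :=
  p • Measure.dirac (c, 0) + m.map (Prod.mk 0)

theorem map_pairLaw_prod (m μ : Measure ℝ) [SFinite m] [IsProbabilityMeasure μ] (p : ENNReal)
    (c : ℝ) :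
    ((pairLaw m p c).prod μ).map (fun ω => ω.1.1 * ω.2 + ω.1.2)
      = m + p • μ.map (fun x => c * x) := by
  have hφ : Measurable fun ω : (ℝ × ℝ) × ℝ => ω.1.1 * ω.2 + ω.1.2 := by fun_prop
  have h1 : (m.map (Prod.mk (0 : ℝ))).prod μ
      = (m.prod μ).map (Prod.map (Prod.mk (0 : ℝ)) id) := by
    conv_lhs => rw [← Measure.map_id (μ := μ)]
    exact Measure.map_prod_map _ _ (by fun_prop) measurable_id
  rw [pairLaw, Measure.add_prod, Measure.prod_smul_left, Measure.dirac_prod, h1,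
    Measure.map_add _ _ hφ, Measure.map_smul, Measure.map_map hφ (by fun_prop),
    Measure.map_map hφ (by fun_prop), add_comm]
  congr 1
  · have : (fun ω : (ℝ × ℝ) × ℝ => ω.1.1 * ω.2 + ω.1.2) ∘ Prod.map (Prod.mk (0 : ℝ)) id
        = Prod.fst := by ext; simp
    rw [this, Measure.map_fst_prod, measure_univ, one_smul]
  · congr 2
    ext x; simp

theorem map_fst_pairLaw (m : Measure ℝ) (p : ENNReal) (c : ℝ) :
    (pairLaw m p c).map Prod.fst = p • Measure.dirac c + m Set.univ • Measure.dirac 0 := by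
  rw [pairLaw, Measure.map_add _ _ measurable_fst, Measure.map_smul,
    Measure.map_dirac' measurable_fst, Measure.map_map measurable_fst (by fun_prop)]
  congr 1
  exact Measure.map_const m 0

theorem map_snd_pairLaw (m : Measure ℝ) (p : ENNReal) (c : ℝ) :
    (pairLaw m p c).map Prod.snd = p • Measure.dirac 0 + m := by
  rw [pairLaw, Measure.map_add _ _ measurable_snd, Measure.map_smul,
    Measure.map_dirac' measurable_snd, Measure.map_map measurable_snd (by fun_prop)]
  congr 1
  exact Measure.map_id

/-- A variable with law `e^{-κh} δ_{e^h} + (1 - e^{-κh}) δ₀` satisfies (A1). -/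
theorem assumptionA1_of_map_eq {Ω : Type*} [MeasurableSpace Ω] {P : Measure Ω} {A : Ω → ℝ}
    {κ h : ℝ} {w : ENNReal} (hw : w ≠ ⊤) (hκ : 0 < κ) (hh : 0 < h) (hA : Measurable A)
    (hlaw : P.map A = ENNReal.ofReal (Real.exp (-(κ * h))) • Measure.dirac (Real.exp h)
      + w • Measure.dirac 0) :
    AssumptionA1 P A κ h := by
  have hmem : ∀ᵐ ω ∂P, A ω = Real.exp h ∨ A ω = 0 := by
    have : ∀ᵐ x ∂(P.map A), x = Real.exp h ∨ x = 0 := by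
      rw [hlaw, ae_add_measure_iff]
      exact ⟨Measure.ae_smul_measure (by simp [ae_dirac_eq]) _,
        Measure.ae_smul_measure (by simp [ae_dirac_eq]) _⟩
    exact ae_of_ae_map hA.aemeasurable this
  refine ⟨hκ, ?_, ?_, ?_, hh, ?_, fun h' hh' hP => ?_⟩
  · filter_upwards [hmem] with ω hω
    rcases hω with hω | hω <;> rw [hω]
    positivity
  · have hf : Measurable fun x : ℝ => x ^ κ := by fun_prop
    rw [← integral_map (f := fun x : ℝ => x ^ κ) hA.aemeasurable hf.aestronglyMeasurable, hlaw,
      integral_add_measure ((integrable_dirac (by simp)).smul_measure (by simp))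
        ((integrable_dirac (by simp)).smul_measure hw),
      integral_smul_measure, integral_smul_measure, integral_dirac, integral_dirac,
      Real.zero_rpow hκ.ne', ENNReal.toReal_ofReal (Real.exp_pos _).le, ← Real.exp_mul,
      smul_zero, add_zero, smul_eq_mul, ← Real.exp_add, mul_comm h κ, neg_add_cancel,
      Real.exp_zero]
  · have hf : Measurable fun x : ℝ => ENNReal.ofReal (x ^ κ * max (Real.log x) 0) := by fun_prop
    rw [← lintegral_map (f := fun x : ℝ => ENNReal.ofReal (x ^ κ * max (Real.log x) 0)) hf hA, hlaw,
      lintegral_add_measure, lintegral_smul_measure, lintegral_smul_measure, lintegral_dirac,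
      lintegral_dirac]
    simp only [smul_eq_mul]
    exact ENNReal.add_lt_top.2 ⟨ENNReal.mul_lt_top (by simp) (by simp),
      ENNReal.mul_lt_top hw.lt_top (by simp)⟩
  · refine measure_mono_null (t := {ω | ¬(A ω = Real.exp h ∨ A ω = 0)}) ?_ hmem
    rintro ω ⟨h0, hk⟩ (hω | hω)
    · exact hk 1 (by simp [hω])
    · exact h0 hω
  · by_contra! hlt
    have hsub : A ⁻¹' {Real.exp h} ⊆ {ω | A ω ≠ 0 ∧ ∀ k : ℤ, Real.log (A ω) ≠ (k : ℝ) * h'} := by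
      intro ω hω
      have hω : A ω = Real.exp h := hω
      refine ⟨by rw [hω]; positivity, fun k hk => ?_⟩
      rw [hω, Real.log_exp] at hk
      have h1 : (0 : ℝ) < k := by
        by_contra! hk0
        nlinarith
      have h2 : (1 : ℝ) ≤ k := by exact_mod_cast h1
      nlinarith
    have h0 := measure_mono_null hsub hP
    rw [← Measure.map_apply hA (measurableSet_singleton _), hlaw] at h0
    simp only [Measure.add_apply, Measure.smul_apply, smul_eq_mul, add_eq_zero, mul_eq_zero,
      ENNReal.ofReal_eq_zero] at h0
    rcases h0.1 with h0 | h0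
    · exact absurd h0 (not_le.2 (Real.exp_pos _))
    · simp at h0

/-- The tail function `x ↦ x^{-κ} q(x)` attached to `q`. -/
def tailFun (κ : ℝ) (q : ℝ → ℝ) (x : ℝ) : ℝ := x ^ (-κ) * q x

namespace MemQ

variable {κ h : ℝ} {q : ℝ → ℝ}

theorem mul_exp_nat (hq : MemQ κ h q) {x : ℝ} (hx : 0 < x) (n : ℕ) :
    q (x * Real.exp (n * h)) = q x := by
  induction n with
  | zero => simp
  | succ n ih =>
    rw [← ih, ← hq.2.2 (x * Real.exp (n * h)) (by positivity), mul_assoc, ← Real.exp_add]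
    congr 3
    push_cast; ring

theorem tailFun_nonneg (hq : MemQ κ h q) {x : ℝ} (hx : 0 < x) : 0 ≤ tailFun κ q x :=
  mul_nonneg (by positivity) (hq.1 x hx)

theorem tailFun_mul_exp_nat (hq : MemQ κ h q) {x : ℝ} (hx : 0 < x) (n : ℕ) :
    tailFun κ q (x * Real.exp (n * h)) = Real.exp (-(κ * (n * h))) * tailFun κ q x := by
  rw [tailFun, tailFun, hq.mul_exp_nat hx, Real.mul_rpow hx.le (Real.exp_pos _).le,
    ← Real.exp_mul]
  ring_nf

theorem tailFun_mul_exp (hq : MemQ κ h q) {x : ℝ} (hx : 0 < x) :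
    tailFun κ q (x * Real.exp h) = Real.exp (-(κ * h)) * tailFun κ q x := by
  simpa using hq.tailFun_mul_exp_nat hx 1

theorem continuousWithinAt_tailFun {x : ℝ} (hx : 0 < x)
    (hrc : ContinuousWithinAt q (Set.Ici x) x) :
    ContinuousWithinAt (tailFun κ q) (Set.Ici x) x :=
  (Real.continuousAt_rpow_const x (-κ) (Or.inl hx.ne')).continuousWithinAt.mul hrc

theorem tendsto_of_tail_eq (hq : MemQ κ h q) (hh : 0 < h) {T : ℝ → ℝ} {a : ℝ}
    (hT : ∀ y, a ≤ y → T y = tailFun κ q y) {x : ℝ} (hx : 0 < x) :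
    Tendsto (fun n : ℕ => x ^ κ * Real.exp (κ * (n * h)) * T (x * Real.exp (n * h))) atTop
      (𝓝 (q x)) := by
  have hlim : Tendsto (fun n : ℕ => x * Real.exp (n * h)) atTop atTop :=
    (Real.tendsto_exp_atTop.comp
      (tendsto_natCast_atTop_atTop.atTop_mul_const hh)).const_mul_atTop hx
  refine tendsto_const_nhds.congr' ?_
  filter_upwards [hlim.eventually_ge_atTop a] with n hn
  rw [hT _ hn, hq.tailFun_mul_exp_nat hx, tailFun, Real.exp_neg, Real.rpow_neg hx.le]
  have h1 : x ^ κ ≠ 0 := by positivity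
  have h2 : Real.exp (κ * (n * h)) ≠ 0 := by positivity
  field_simp

end MemQ

/-- A scale recursion for a measure determines its right tail. -/
theorem real_Ioi_eq_of_eq_add_smul_map {μ m : Measure ℝ} [IsFiniteMeasure μ] {G : ℝ → ℝ}
    {a c r : ℝ} (ha : 0 < a) (hc : 1 < c) (hr : 0 < r) (hr1 : r < 1)
    (hG : ∀ y, 0 < y → G (y * c) = r * G y) (hanti : AntitoneOn G (Set.Ioi 0))
    (hμ : μ = m + ENNReal.ofReal r • μ.map (fun x => c * x))
    (hm : ∀ y, 0 ≤ y →
      m (Set.Ioi y) = ENNReal.ofReal (G (max a (min y (a * c))) - G (a * c))) :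
    ∀ y, a ≤ y → μ.real (Set.Ioi y) = G y := by
  have hc0 : 0 < c := by linarith
  refine tail_eq_of_recursion ha hc hr hr1 hG
    (fun x y hxy => measureReal_mono (Set.Ioi_subset_Ioi hxy)) fun y hy => ?_
  have hpre : (fun x => c * x) ⁻¹' Set.Ioi y = Set.Ioi (y / c) := by
    ext x
    simp [div_lt_iff₀' hc0]
  have hnn : 0 ≤ G (max a (min y (a * c))) - G (a * c) :=
    sub_nonneg.2 <| hanti (Set.mem_Ioi.2 (lt_max_of_lt_left ha)) (Set.mem_Ioi.2 (by positivity))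
      (max_le (by nlinarith) (min_le_right _ _))
  have h := congrArg (fun ν : Measure ℝ => ν (Set.Ioi y)) hμ
  simp only [Measure.add_apply, Measure.smul_apply, smul_eq_mul] at h
  rw [Measure.map_apply (by fun_prop) measurableSet_Ioi, hpre, hm y hy] at h
  rw [measureReal_def, h, ENNReal.toReal_add (by finiteness) (by finiteness), ENNReal.toReal_mul,
    ENNReal.toReal_ofReal hnn, ENNReal.toReal_ofReal hr.le, measureReal_def]

/-- Right part `ν₁`, reflected left part `ν₂`, and an atom of mass `d` at the origin. -/
def signedMix (ν₁ ν₂ : Measure ℝ) (d : ENNReal) : Measure ℝ :=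
  ν₁ + ν₂.map Neg.neg + d • Measure.dirac 0

theorem map_neg_signedMix (ν₁ ν₂ : Measure ℝ) (d : ENNReal) :
    (signedMix ν₁ ν₂ d).map Neg.neg = signedMix ν₂ ν₁ d := by
  rw [signedMix, signedMix, Measure.map_add _ _ measurable_neg, Measure.map_add _ _ measurable_neg,
    Measure.map_smul, Measure.map_dirac' measurable_neg, Measure.map_map measurable_neg
    measurable_neg, neg_zero, neg_comp_neg, Measure.map_id, add_comm ν₂]

theorem signedMix_Ioi {ν₁ ν₂ : Measure ℝ} {d : ENNReal} (h₂ : ν₂ (Set.Iic 0) = 0) {y : ℝ}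
    (hy : 0 ≤ y) : signedMix ν₁ ν₂ d (Set.Ioi y) = ν₁ (Set.Ioi y) := by
  have h0 : ν₂ (Neg.neg ⁻¹' Set.Ioi y) = 0 := by
    refine measure_mono_null (fun x hx => ?_) h₂
    have hx : y < -x := hx
    exact Set.mem_Iic.2 (by linarith)
  rw [signedMix, Measure.add_apply, Measure.add_apply,
    Measure.map_apply measurable_neg measurableSet_Ioi, h0]
  simp [hy, not_lt]

theorem signedMix_univ (ν₁ ν₂ : Measure ℝ) (d : ENNReal) :
    signedMix ν₁ ν₂ d Set.univ = ν₁ Set.univ + ν₂ Set.univ + d := by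
  simp [signedMix, Measure.map_apply measurable_neg MeasurableSet.univ]

theorem ae_abs_le_of_measure_Ioi_eq_zero {m : Measure ℝ} {b : ℝ} (h₁ : m (Set.Ioi b) = 0)
    (h₂ : m.map Neg.neg (Set.Ioi b) = 0) : ∀ᵐ x ∂m, |x| ≤ b := by
  rw [Measure.map_apply measurable_neg measurableSet_Ioi] at h₂
  have e₁ : ∀ᵐ x ∂m, x ∉ Set.Ioi b := measure_eq_zero_iff_ae_notMem.1 h₁
  have e₂ : ∀ᵐ x ∂m, x ∉ Neg.neg ⁻¹' Set.Ioi b := measure_eq_zero_iff_ae_notMem.1 h₂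
  filter_upwards [e₁, e₂] with x hx₁ hx₂
  simp only [Set.mem_preimage, Set.mem_Ioi, not_lt] at hx₁ hx₂
  exact abs_le.2 ⟨by linarith, hx₁⟩

/-- Proposition 1 (perpetuity part): every pair of right-continuous `q₁, q₂ ∈ 𝒬(κ,h)`
with `q₁ + q₂` not identically zero arises as the pair of tail functions of the unique
solution of a perpetuity equation `X =_d AX + B` with `(A,B)` satisfying the conditions
of Theorem 2. -/
theorem stmt6 (κ h : ℝ) (hκ : 0 < κ) (hh : 0 < h)
    (q₁ q₂ : ℝ → ℝ) (hq₁ : MemQ κ h q₁) (hq₂ : MemQ κ h q₂)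
    (hq₁rc : ∀ x : ℝ, 0 < x → ContinuousWithinAt q₁ (Set.Ici x) x)
    (hq₂rc : ∀ x : ℝ, 0 < x → ContinuousWithinAt q₂ (Set.Ici x) x)
    (hne : ∃ x : ℝ, 0 < x ∧ q₁ x + q₂ x ≠ 0) :
    ∃ (Ω : Type) (_ : MeasurableSpace Ω) (P : Measure Ω) (_ : IsProbabilityMeasure P)
      (A B X : Ω → ℝ),
      Measurable A ∧ Measurable B ∧ Measurable X ∧
      AssumptionA1 P A κ h ∧
      (∫⁻ ω, ENNReal.ofReal (|B ω| ^ κ) ∂P) < ⊤ ∧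
      IndepFun (fun ω => (A ω, B ω)) X P ∧
      Measure.map X P = Measure.map (fun ω => A ω * X ω + B ω) P ∧
      (∀ x : ℝ, 0 < x → ContinuousAt q₁ x →
        Tendsto (fun n : ℕ =>
            x ^ κ * Real.exp (κ * (n * h)) * (P {ω | X ω > x * Real.exp (n * h)}).toReal)
          atTop (𝓝 (q₁ x))) ∧
      (∀ x : ℝ, 0 < x → ContinuousAt q₂ x →
        Tendsto (fun n : ℕ =>
            x ^ κ * Real.exp (κ * (n * h)) * (P {ω | X ω < -(x * Real.exp (n * h))}).toReal)
          atTop (𝓝 (q₂ x))) := by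
  have hr : 0 < Real.exp (-(κ * h)) := Real.exp_pos _
  have hr1 : Real.exp (-(κ * h)) < 1 := Real.exp_lt_one_iff.2 (neg_lt_zero.2 (mul_pos hκ hh))
  have hc : 1 < Real.exp h := Real.one_lt_exp_iff.2 hh
  obtain ⟨a, ha, ha1⟩ : ∃ a : ℝ, 0 < a ∧ tailFun κ q₁ a + tailFun κ q₂ a ≤ 1 := by
    have hlim : Tendsto (fun n : ℕ =>
        Real.exp (-(κ * (n * h))) * (tailFun κ q₁ 1 + tailFun κ q₂ 1)) atTop (𝓝 0) := by
      rw [← zero_mul (tailFun κ q₁ 1 + tailFun κ q₂ 1)]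
      refine Tendsto.mul_const _ (Real.tendsto_exp_neg_atTop_nhds_zero.comp ?_)
      exact (tendsto_natCast_atTop_atTop.atTop_mul_const hh).const_mul_atTop hκ
    obtain ⟨n, hn⟩ := (hlim.eventually_le_const one_pos).exists
    refine ⟨1 * Real.exp (n * h), by positivity, ?_⟩
    rwa [hq₁.tailFun_mul_exp_nat one_pos, hq₂.tailFun_mul_exp_nat one_pos, ← mul_add]
  have hb : 0 < a * Real.exp h := by positivity
  have hab : a ≤ a * Real.exp h := by nlinarith
  have hG₁ := fun y (hy : 0 < y) => hq₁.tailFun_mul_exp hy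
  have hG₂ := fun y (hy : 0 < y) => hq₂.tailFun_mul_exp hy
  obtain ⟨ν₁, hν₁, hν₁0, hν₁t⟩ := exists_measure_Ioi_eq (G := tailFun κ q₁) hq₁.2.1
    (fun x hx => MemQ.continuousWithinAt_tailFun hx (hq₁rc x hx)) ha hab
  obtain ⟨ν₂, hν₂, hν₂0, hν₂t⟩ := exists_measure_Ioi_eq (G := tailFun κ q₂) hq₂.2.1
    (fun x hx => MemQ.continuousWithinAt_tailFun hx (hq₂rc x hx)) ha hab
  set r := Real.exp (-(κ * h)) with hr_def
  set d := ENNReal.ofReal ((1 - r) * (1 - (tailFun κ q₁ a + tailFun κ q₂ a))) with hd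
  set m := signedMix ν₁ ν₂ d with hm_def
  have hm : m Set.univ = 1 - ENNReal.ofReal r := by
    have h1 := hq₁.tailFun_nonneg ha
    have h2 := hq₂.tailFun_nonneg ha
    have h3 : 0 ≤ 1 - r := by linarith
    have h4 : 0 ≤ 1 - (tailFun κ q₁ a + tailFun κ q₂ a) := by linarith
    rw [hm_def, signedMix_univ, hν₁, hν₂, hG₁ a ha, hG₂ a ha, hd,
      ← ENNReal.ofReal_add (by nlinarith) (by nlinarith),
      ← ENNReal.ofReal_add (by nlinarith) (by positivity), ← ENNReal.ofReal_one,
      ← ENNReal.ofReal_sub _ hr.le]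
    congr 1; ring
  have hp : ENNReal.ofReal r < 1 := by simpa using hr1
  obtain ⟨μ, hμp, hμ⟩ := exists_eq_add_smul_map m _ hp hm (Real.exp h)
  have hmfin : IsFiniteMeasure m := ⟨by rw [hm]; exact lt_of_le_of_lt tsub_le_self (by simp)⟩
  have hmI : ∀ y, 0 ≤ y → m (Set.Ioi y) = _ := fun y hy =>
    (signedMix_Ioi hν₂0 hy).trans (hν₁t y)
  have hmN : ∀ y, 0 ≤ y → m.map Neg.neg (Set.Ioi y) = _ := fun y hy =>
    (congrArg (fun ν : Measure ℝ => ν (Set.Ioi y)) (map_neg_signedMix ν₁ ν₂ d)).trans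
      ((signedMix_Ioi hν₁0 hy).trans (hν₂t y))
  have hμN : μ.map Neg.neg = m.map Neg.neg
      + ENNReal.ofReal r • (μ.map Neg.neg).map (fun x => Real.exp h * x) := by
    conv_lhs => rw [hμ]
    rw [Measure.map_add _ _ measurable_neg, Measure.map_smul,
      Measure.map_map measurable_neg (by fun_prop), Measure.map_map (by fun_prop) measurable_neg]
    congr 3
    ext x
    simp
  have hT₁ := real_Ioi_eq_of_eq_add_smul_map ha hc hr hr1 hG₁ hq₁.2.1 hμ hmI
  have hT₂ := real_Ioi_eq_of_eq_add_smul_map ha hc hr hr1 hG₂ hq₂.2.1 hμN hmN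
  have hpair : IsProbabilityMeasure (pairLaw m (ENNReal.ofReal r) (Real.exp h)) := by
    constructor
    rw [← Set.preimage_univ (f := Prod.snd), ← Measure.map_apply measurable_snd MeasurableSet.univ,
      map_snd_pairLaw]
    simp [hm, add_tsub_cancel_of_le hp.le]
  set P := (pairLaw m (ENNReal.ofReal r) (Real.exp h)).prod μ with hP
  have hPfst : P.map Prod.fst = pairLaw m (ENNReal.ofReal r) (Real.exp h) := by
    rw [hP, Measure.map_fst_prod, measure_univ, one_smul]
  have hPsnd : P.map Prod.snd = μ := by
    rw [hP, Measure.map_snd_prod, measure_univ, one_smul]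
  have hA : P.map (fun ω => ω.1.1) = ENNReal.ofReal r • Measure.dirac (Real.exp h)
      + m Set.univ • Measure.dirac 0 := by
    rw [← map_fst_pairLaw, ← hPfst, Measure.map_map measurable_fst measurable_fst]
    rfl
  have hB : P.map (fun ω => ω.1.2) = ENNReal.ofReal r • Measure.dirac 0 + m := by
    rw [← map_snd_pairLaw m _ (Real.exp h), ← hPfst, Measure.map_map measurable_snd measurable_fst]
    rfl
  refine ⟨(ℝ × ℝ) × ℝ, inferInstance, P, inferInstance, fun ω => ω.1.1, fun ω => ω.1.2,
    fun ω => ω.2, by fun_prop, by fun_prop, by fun_prop,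
    assumptionA1_of_map_eq (by finiteness) hκ hh (by fun_prop) hA, ?_, ?_, ?_, ?_, ?_⟩
  · have hf : Measurable fun x : ℝ => ENNReal.ofReal (|x| ^ κ) := by fun_prop
    have hbd : ∀ᵐ x ∂m, |x| ≤ a * Real.exp h :=
      ae_abs_le_of_measure_Ioi_eq_zero
        (by rw [hmI _ hb.le, min_self, max_eq_right hab, sub_self, ENNReal.ofReal_zero])
        (by rw [hmN _ hb.le, min_self, max_eq_right hab, sub_self, ENNReal.ofReal_zero])
    rw [← lintegral_map (f := fun x : ℝ => ENNReal.ofReal (|x| ^ κ)) (g := fun ω : (ℝ × ℝ) × ℝ => ω.1.2) hf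
      (by fun_prop), hB, lintegral_add_measure, lintegral_smul_measure, lintegral_dirac]
    refine ENNReal.add_lt_top.2 ⟨by simp [hκ.ne'], ?_⟩
    calc ∫⁻ x, ENNReal.ofReal (|x| ^ κ) ∂m
        ≤ ∫⁻ _, ENNReal.ofReal ((a * Real.exp h) ^ κ) ∂m := by
          refine lintegral_mono_ae ?_
          filter_upwards [hbd] with x hx
          gcongr
      _ < ⊤ := by
          rw [lintegral_const]
          finiteness
  · exact indepFun_prod (X := id) (Y := id) measurable_id measurable_id
  · change P.map Prod.snd = _
    rw [hPsnd, hP, map_pairLaw_prod, ← hμ]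
  · intro x hx _
    refine (hq₁.tendsto_of_tail_eq hh hT₁ hx).congr fun n => ?_
    rw [← hPsnd, map_measureReal_apply measurable_snd measurableSet_Ioi]
    rfl
  · intro x hx _
    refine (hq₂.tendsto_of_tail_eq hh hT₂ hx).congr fun n => ?_
    rw [map_measureReal_apply measurable_neg measurableSet_Ioi, ← hPsnd,
      map_measureReal_apply measurable_snd (measurable_neg measurableSet_Ioi), measureReal_def]
    congr 3
    ext ω
    simp [lt_neg]
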